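/- Let h : K → K be a quadratic function, let E = (K,+) be the translation group, and set H = Aut(C_h) (so E ≤ H). Assume that for every permutation π of K with π E π⁻¹ ≤ H there exists h_π ∈ H such that π E π⁻¹ = h_π E h_π⁻¹. Then every quadratic function f : K → K that is CCZ-equivalent to h (i.e., such that σ(C_f) = C_h for some permutation σ of K) is EA-equivalent to h. -/

import Mathlib

/-- The code `C_f` associated to a function `f : K → K`. -/
def code {K : Type*} [Field K] [Algebra (ZMod 2) K] (f : K → K) : Set (K → ZMod 2) :=
  {c | ∃ (α β : K) (ε : ZMod 2),
    c = fun x => Algebra.trace (ZMod 2) K (α * x) + Algebra.trace (ZMod 2) K (β * f x) + ε}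

/-- The automorphism group of a code `C ⊆ F₂^K`, as a set of permutations of `K`:
those `π` with `{c ∘ π : c ∈ C} = C`. -/
def autSet {K : Type*} (C : Set (K → ZMod 2)) : Set (Equiv.Perm K) :=
  {π | (fun c : K → ZMod 2 => c ∘ ⇑π) '' C = C}

/-- The translation group `(K,+)` inside `Sym(K)`, as a set of permutations. -/
def transSet (K : Type*) [Field K] : Set (Equiv.Perm K) :=
  {π | ∃ a : K, ∀ x, π x = x + a}

/-- An affine map `K → K`. -/
def IsAffineMap {K : Type*} [Field K] [Algebra (ZMod 2) K] (A : K → K) : Prop :=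
  ∃ (L : K →ₗ[ZMod 2] K) (t : K), ∀ x, A x = L x + t

/-- EA-equivalence of functions `K → K`. -/
def EAEquiv {K : Type*} [Field K] [Algebra (ZMod 2) K] (f g : K → K) : Prop :=
  ∃ A₁ A₂ A : K → K, IsAffineMap A₁ ∧ Function.Bijective A₁ ∧
    IsAffineMap A₂ ∧ Function.Bijective A₂ ∧ IsAffineMap A ∧
    ∀ x, g x = A₁ (f (A₂ x)) + A x

theorem map_add_symm {R : Type*} [CommRing R] {e : Equiv.Perm R}
    (he : ∀ x y, e (x + y) = e x + e y - e 0) (x y : R) :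
    e.symm (x + y) = e.symm x + e.symm y - e.symm 0 := by
  have h := he (e.symm x + e.symm y - e.symm 0) (e.symm 0)
  have h' := he (e.symm x) (e.symm y)
  rw [sub_add_cancel, h'] at h
  simp only [Equiv.apply_symm_apply] at h
  rw [Equiv.symm_apply_eq]
  linear_combination h

section

variable {K : Type*} [Field K] [Algebra (ZMod 2) K]

/-- The space of affine functions `K → F₂`. -/
def affineFunctions (K : Type*) [Field K] [Algebra (ZMod 2) K] :
    Submodule (ZMod 2) (K → ZMod 2) where
  carrier := {c | ∀ x y, c (x + y) = c x + c y - c 0}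
  add_mem' {c d} hc hd x y := by
    simp only [Pi.add_apply, hc x y, hd x y]
    ring
  zero_mem' := by simp
  smul_mem' r c hc x y := by
    simp only [Pi.smul_apply, smul_eq_mul, hc x y]
    ring

/-- An additive-affine self-map, in the functional-equation form, is an affine map. -/
theorem isAffineMap_of_map_add {A : K → K} (hA : ∀ x y, A (x + y) = A x + A y - A 0) :
    IsAffineMap A := by
  let L : K →+ K :=
    { toFun := fun x => A x - A 0
      map_zero' := sub_self _
      map_add' := fun x y => by rw [hA]; ring }
  exact ⟨L.toZModLinearMap 2, A 0, fun x => (sub_add_cancel (A x) (A 0)).symm⟩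

theorem comp_mem_affineFunctions {c : K → ZMod 2} (hc : c ∈ affineFunctions K) {A : K → K}
    (hA : ∀ x y, A (x + y) = A x + A y - A 0) : c ∘ A ∈ affineFunctions K := by
  obtain ⟨L, t, hL⟩ := isAffineMap_of_map_add hA
  intro x y
  have h₁ := hc (L x + t) (L y)
  have h₂ := hc (L y) t
  simp only [Function.comp_apply, hL, map_add, map_zero, zero_add]
  rw [show L x + L y + t = L x + t + L y by ring, h₁, h₂]
  ring

/-- The component map `β ↦ Tr(β f)`. -/
noncomputable def component (f : K → K) : K →ₗ[ZMod 2] (K → ZMod 2) :=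
  LinearMap.pi fun x => Algebra.trace (ZMod 2) K ∘ₗ LinearMap.mulRight (ZMod 2) (f x)

@[simp]
theorem component_apply (f : K → K) (β x : K) :
    component f β x = Algebra.trace (ZMod 2) K (β * f x) :=
  rfl

theorem exists_linearEquiv_comp_eq {k V W : Type*} [Field k] [AddCommGroup V] [Module k V]
    [FiniteDimensional k V] [AddCommGroup W] [Module k W] {φ ψ : V →ₗ[k] W}
    (h : LinearMap.range φ = LinearMap.range ψ) : ∃ e : V ≃ₗ[k] V, ∀ v, ψ (e v) = φ v := by
  obtain ⟨P, hP⟩ := φ.ker.exists_isCompl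
  obtain ⟨Q, hQ⟩ := ψ.ker.exists_isCompl
  have hker : Module.finrank k φ.ker = Module.finrank k ψ.ker := by
    have h₁ := φ.finrank_range_add_finrank_ker
    have h₂ := ψ.finrank_range_add_finrank_ker
    rw [h] at h₁
    omega
  let eker : φ.ker ≃ₗ[k] ψ.ker := LinearEquiv.ofFinrankEq _ _ hker
  let eP := φ.kerComplementEquivRange hP.symm
  let eQ := ψ.kerComplementEquivRange hQ.symm
  let ec : P ≃ₗ[k] Q := eP ≪≫ₗ LinearEquiv.ofEq _ _ h ≪≫ₗ eQ.symm
  have hec (p : P) : ψ (ec p) = φ p := by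
    change ((eQ (ec p) : LinearMap.range ψ) : W) = _
    simp [ec, eP]
  refine ⟨(Submodule.prodEquivOfIsCompl _ _ hP).symm ≪≫ₗ
    (LinearEquiv.prodCongr eker ec) ≪≫ₗ Submodule.prodEquivOfIsCompl _ _ hQ, fun v => ?_⟩
  obtain ⟨⟨a, p⟩, rfl⟩ := (Submodule.prodEquivOfIsCompl _ _ hP).surjective v
  simp [hec]

variable [Finite K]

theorem traceForm_nondeg : (Algebra.traceForm (ZMod 2) K).Nondegenerate :=
  traceForm_nondegenerate (ZMod 2) K

theorem eq_zero_of_trace_mul_eq_zero {z : K}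
    (hz : ∀ β : K, Algebra.trace (ZMod 2) K (β * z) = 0) : z = 0 :=
  (traceForm_nondeg (K := K)).2 z hz

theorem mem_affineFunctions_iff_exists {c : K → ZMod 2} : c ∈ affineFunctions K ↔
    ∃ (α : K) (ε : ZMod 2), ∀ x, c x = Algebra.trace (ZMod 2) K (α * x) + ε := by
  constructor
  · intro hc
    let L : K →+ ZMod 2 :=
      { toFun := fun x => c x - c 0
        map_zero' := sub_self _
        map_add' := fun x y => by rw [hc]; ring }
    let B := Algebra.traceForm (ZMod 2) K
    let α := (B.toDual traceForm_nondeg).symm (L.toZModLinearMap 2)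
    refine ⟨α, c 0, fun x => ?_⟩
    have h : B α x = c x - c 0 :=
      LinearMap.BilinForm.apply_toDual_symm_apply (hB := traceForm_nondeg) _ x
    rw [← Algebra.traceForm_apply]
    exact eq_add_of_sub_eq h.symm
  · rintro ⟨α, ε, h⟩ x y
    simp only [h, mul_add, map_add, mul_zero, map_zero]
    ring

theorem mem_code_iff {f : K → K} {c : K → ZMod 2} :
    c ∈ code f ↔ ∃ β, c - component f β ∈ affineFunctions K := by
  simp only [mem_affineFunctions_iff_exists, code, Set.mem_ofPred_eq, funext_iff, Pi.sub_apply,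
    component_apply]
  constructor
  · rintro ⟨α, β, ε, h⟩
    exact ⟨β, α, ε, fun x => by rw [h]; ring⟩
  · rintro ⟨β, α, ε, h⟩
    exact ⟨α, β, ε, fun x => by linear_combination h x⟩

theorem code_comp {f : K → K} {e : Equiv.Perm K} (he : ∀ x y, e (x + y) = e x + e y - e 0) :
    (fun c : K → ZMod 2 => c ∘ ⇑e) '' code f = code (f ∘ e) := by
  ext c
  constructor
  · rintro ⟨c, hc, rfl⟩
    obtain ⟨β, hβ⟩ := mem_code_iff.1 hc
    exact mem_code_iff.2 ⟨β, comp_mem_affineFunctions hβ he⟩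
  · intro hc
    obtain ⟨β, hβ⟩ := mem_code_iff.1 hc
    refine ⟨c ∘ e.symm, mem_code_iff.2 ⟨β, ?_⟩, by ext; simp⟩
    convert comp_mem_affineFunctions hβ (map_add_symm he) using 1
    ext
    simp

/-- Translations preserve the code of a quadratic function. -/
theorem comp_add_mem_code {f : K → K}
    (hf : ∀ a : K, IsLinearMap (ZMod 2) fun x => f (x + a) + f x + f a) (a : K)
    {c : K → ZMod 2} (hc : c ∈ code f) : (fun x => c (x + a)) ∈ code f := by
  have := charP_of_injective_algebraMap (algebraMap (ZMod 2) K).injective 2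
  obtain ⟨β, hβ⟩ := mem_code_iff.1 hc
  refine mem_code_iff.2 ⟨β, ?_⟩
  have hd : (fun x => β * (f (x + a) - f x)) = fun x => β * (f (x + a) + f x + f a) - β * f a := by
    ext x
    rw [CharTwo.sub_eq_add]
    ring
  have hT : (fun x => Algebra.trace (ZMod 2) K (β * (f (x + a) - f x))) ∈ affineFunctions K := by
    intro x y
    simp only [congrFun hd, map_sub, (hf a).map_add, mul_add β (_ + _ + _), map_add, (hf a).map_zero,
      mul_zero, map_zero]
    ring
  convert add_mem (comp_mem_affineFunctions hβ (A := fun x => x + a) fun x y => by ring) hT using 1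
  ext x
  simp [mul_sub]

/-- Functions with the same code are EA-equivalent, the inner affine permutation being trivial. -/
theorem exists_add_of_code_eq {g h : K → K} (hgh : code g = code h) :
    ∃ (L : K →ₗ[ZMod 2] K) (A : K → K), Function.Bijective L ∧ IsAffineMap A ∧
      ∀ x, h x = L (g x) + A x := by
  have hrange (f : K → K) (c : K → ZMod 2) : (affineFunctions K).mkQ c ∈
      LinearMap.range ((affineFunctions K).mkQ ∘ₗ component f) ↔ c ∈ code f := by
    rw [mem_code_iff, LinearMap.mem_range]
    refine exists_congr fun β => ?_
    rw [LinearMap.comp_apply, eq_comm]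
    exact Submodule.Quotient.eq _
  have heq : LinearMap.range ((affineFunctions K).mkQ ∘ₗ component h) =
      LinearMap.range ((affineFunctions K).mkQ ∘ₗ component g) := by
    ext q
    obtain ⟨c, rfl⟩ := (affineFunctions K).mkQ_surjective q
    rw [hrange, hrange, hgh]
  obtain ⟨e, he⟩ := exists_linearEquiv_comp_eq heq
  let B := Algebra.traceForm (ZMod 2) K
  obtain ⟨L, hL⟩ : ∃ L : K →ₗ[ZMod 2] K, ∀ β y,
      Algebra.trace (ZMod 2) K (β * L y) = Algebra.trace (ZMod 2) K (e β * y) := by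
    refine ⟨B.leftAdjointOfNondegenerate traceForm_nondeg e, fun β y => ?_⟩
    have := B.isAdjointPairLeftAdjointOfNondegenerate traceForm_nondeg e y β
    simp only [B, Algebra.traceForm_apply] at this
    rw [mul_comm, this, mul_comm]
    rfl
  have hLinj : Function.Injective L := by
    refine (injective_iff_map_eq_zero L).2 fun y hy => eq_zero_of_trace_mul_eq_zero fun γ => ?_
    obtain ⟨β, rfl⟩ := e.surjective γ
    rw [← hL, hy, mul_zero, map_zero]
  refine ⟨L, fun x => h x - L (g x), Finite.injective_iff_bijective.1 hLinj,
    isAffineMap_of_map_add fun x y => sub_eq_zero.1 ?_, fun x => (add_sub_cancel _ _).symm⟩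
  refine eq_zero_of_trace_mul_eq_zero fun β => ?_
  have hβ : component h β - component g (e β) ∈ affineFunctions K :=
    (Submodule.Quotient.eq _).1 (he β).symm
  have := hβ x y
  simp only [Pi.sub_apply, component_apply, ← hL] at this
  simp only [mul_sub, mul_add, map_sub, map_add]
  linear_combination this

end

/-- Let `h` be quadratic, `E = (K,+)` and `H = Aut(C_h)`.  If every conjugate `π E π⁻¹`
of `E` that lies in `H` is of the form `h_π E h_π⁻¹` for some `h_π ∈ H`, then every
quadratic `f` that is CCZ-equivalent to `h` is EA-equivalent to `h`. -/
theorem stmt5 {K : Type*} [Field K] [Fintype K] [Algebra (ZMod 2) K]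
    (n : ℕ) (hn : 1 ≤ n) (hcard : Fintype.card K = 2 ^ n)
    (h : K → K)
    (hquad : ∀ a : K, IsLinearMap (ZMod 2) fun x => h (x + a) + h x + h a)
    (hconj : ∀ π : Equiv.Perm K,
      (fun σ => π * σ * π⁻¹) '' transSet K ⊆ autSet (code h) →
      ∃ hπ ∈ autSet (code h),
        (fun σ => π * σ * π⁻¹) '' transSet K = (fun σ => hπ * σ * hπ⁻¹) '' transSet K)
    (f : K → K)
    (hfquad : ∀ a : K, IsLinearMap (ZMod 2) fun x => f (x + a) + f x + f a)
    (hccz : ∃ σ : Equiv.Perm K, (fun c : K → ZMod 2 => c ∘ ⇑σ) '' code f = code h) :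
    EAEquiv f h := by
  have := charP_of_injective_algebraMap (algebraMap (ZMod 2) K).injective 2
  obtain ⟨σ, hσ⟩ := hccz
  obtain ⟨k, hk, hE⟩ := hconj σ⁻¹ (by
    rintro _ ⟨τ, ⟨a, hτ⟩, rfl⟩
    have hmem (c) (hc : c ∈ code h) : c ∘ ⇑(σ⁻¹ * τ * σ⁻¹⁻¹) ∈ code h := by
      rw [← hσ] at hc ⊢
      obtain ⟨c, hc, rfl⟩ := hc
      refine ⟨_, comp_add_mem_code hfquad a hc, ?_⟩
      ext x
      simp [hτ]
    refine Set.Subset.antisymm (Set.image_subset_iff.2 hmem) fun c hc => ⟨_, hmem c hc, ?_⟩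
    ext x
    simp [hτ, add_assoc, CharTwo.add_self_eq_zero])
  let ρ : Equiv.Perm K := σ * k
  have hρ (x y) : ρ (x + y) = ρ x + ρ y - ρ 0 := by
    obtain ⟨τ, ⟨a, hτ⟩, hτk⟩ := hE.ge ⟨Equiv.addRight y, ⟨y, fun _ => rfl⟩, rfl⟩
    have key (z) : ρ (z + y) = ρ z + a := by
      have := congrArg σ (Equiv.congr_fun hτk (k z))
      simpa [hτ, ρ] using this.symm
    have h₀ := key 0
    rw [zero_add] at h₀
    rw [key, h₀]
    ring
  have hcode : code (f ∘ ρ) = code h := by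
    rw [← code_comp hρ]
    refine Eq.trans ?_ hk
    rw [← hσ, Set.image_image]
    rfl
  obtain ⟨L, A, hL, hA, hh⟩ := exists_add_of_code_eq hcode
  exact ⟨L, ρ, A, ⟨L, 0, fun x => (add_zero _).symm⟩, hL, isAffineMap_of_map_add hρ, ρ.bijective,
    hA, hh⟩
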